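/- Let k be a global function field of characteristic p, i.e. a finite extension of the rational function field 𝔽_q(t) over a finite field 𝔽_q of characteristic p. Let ℓ be a prime with ℓ ≠ p, let E be a finite field extension of ℚ_ℓ, and let χ : Gal(k^sep/k) → Eˣ be a continuous group homomorphism, where Gal(k^sep/k) carries the Krull topology and Eˣ the topology induced by the unique extension to E of the ℓ-adic absolute value. Then there exists a positive integer N such that the character χ^N is unramified at every place of k; that is, for every place v of k and every extension of v to the separable closure k^sep, the associated inertia subgroup of Gal(k^sep/k) is contained in the kernel of χ^N. -/

import Mathlib

section PointwiseAction

open scoped Pointwise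

namespace ValuationSubring

variable {k K : Type*} [Field k] [Field K] [Algebra k K]

/-- An algebraic element is a root of a polynomial whose coefficients are integral for a given
valuation, with a coefficient `1` above which all coefficients have valuation `< 1`. -/
theorem exists_aeval_eq_zero_coeff_eq_one [Algebra.IsAlgebraic k K] (B : ValuationSubring K)
    (b : K) : ∃ (f : Polynomial k) (j : ℕ), Polynomial.aeval b f = 0 ∧ f.coeff j = 1 ∧
      (∀ i, B.valuation (algebraMap k K (f.coeff i)) ≤ 1) ∧
      ∀ i, j < i → B.valuation (algebraMap k K (f.coeff i)) < 1 := by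
  obtain ⟨p, hp0, hp⟩ := Algebra.IsAlgebraic.isAlgebraic (R := k) b
  let v := B.valuation.comap (algebraMap k K)
  have hv (a : k) : B.valuation (algebraMap k K a) = v a := rfl
  obtain ⟨j, hj, hmax⟩ := p.support.exists_max_image (fun i ↦ toLex (v (p.coeff i), i))
    (by simpa using hp0)
  have hj0 : p.coeff j ≠ 0 := by simpa using hj
  have hvj : 0 < v (p.coeff j) := zero_lt_iff.2 (by simpa using hj0)
  have key (i : ℕ) : v (p.coeff i) ≤ v (p.coeff j) ∧
      (j < i → v (p.coeff i) < v (p.coeff j)) := by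
    by_cases hi : p.coeff i = 0
    · exact ⟨by simp [hi], fun _ ↦ by simpa [hi] using hvj⟩
    · have := hmax i (by simpa using hi)
      rw [Prod.Lex.toLex_le_toLex] at this
      rcases this with h | ⟨h, h'⟩
      · exact ⟨h.le, fun _ ↦ h⟩
      · exact ⟨h.le, fun hji ↦ absurd h' (by simpa using hji)⟩
  refine ⟨Polynomial.C (p.coeff j)⁻¹ * p, j, by simp [hp], by simp [hj0], fun i ↦ ?_,
    fun i hi ↦ ?_⟩
  · rw [hv, Polynomial.coeff_C_mul, map_mul, map_inv₀, inv_mul_le_iff₀ hvj, mul_one]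
    exact (key i).1
  · rw [hv, Polynomial.coeff_C_mul, map_mul, map_inv₀, inv_mul_lt_iff₀ hvj, mul_one]
    exact (key i).2 hi

/-- Elements of a valuation ring are quotients of elements integral over the trace of the ring
on the base field, with denominator a unit. -/
theorem exists_isIntegral_mul_isIntegral [Algebra.IsAlgebraic k K] (B : ValuationSubring K)
    {b : K} (hb : b ∈ B) : ∃ y : K, B.valuation y = 1 ∧
      IsIntegral (B.comap (algebraMap k K)) y ∧ IsIntegral (B.comap (algebraMap k K)) (y * b) := by
  set A := B.comap (algebraMap k K)
  obtain ⟨f, j, hf, hj, hle, hlt⟩ := B.exists_aeval_eq_zero_coeff_eq_one b (k := k)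
  let a (i : ℕ) : K := algebraMap k K (f.coeff i)
  have ha (i) : f.coeff i ∈ A := by
    rw [mem_comap, ← valuation_le_one_iff]; exact hle i
  by_cases hb0 : b = 0
  · exact ⟨1, by simp, isIntegral_one, by simpa [hb0] using isIntegral_zero⟩
  set n := f.natDegree
  have hjn : j ≤ n := Polynomial.le_natDegree_of_ne_zero (by simp [hj])
  let y := ∑ i ∈ Finset.Ico j (n + 1), a i * b ^ (i - j)
  have hsum : ∑ i ∈ Finset.range j, a i * b ^ i + b ^ j * y = 0 := by
    rw [Finset.mul_sum]
    have : ∑ i ∈ Finset.Ico j (n + 1), b ^ j * (a i * b ^ (i - j)) =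
        ∑ i ∈ Finset.Ico j (n + 1), a i * b ^ i := by
      refine Finset.sum_congr rfl fun i hi ↦ ?_
      obtain ⟨d, rfl⟩ := Nat.exists_eq_add_of_le (Finset.mem_Ico.1 hi).1
      simp only [Nat.add_sub_cancel_left]; ring
    rw [this, Finset.sum_range_add_sum_Ico _ (by omega)]
    rw [Polynomial.aeval_eq_sum_range] at hf
    simpa [Algebra.smul_def] using hf
  have hyb : y * b = - ∑ i ∈ Finset.range j, a i * b⁻¹ ^ (j - 1 - i) := by
    have h1 : b ^ j * (y * b) = b ^ j * (- ∑ i ∈ Finset.range j, a i * b⁻¹ ^ (j - 1 - i)) := by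
      have : b ^ j * (∑ i ∈ Finset.range j, a i * b⁻¹ ^ (j - 1 - i)) =
          (∑ i ∈ Finset.range j, a i * b ^ i) * b := by
        rw [Finset.mul_sum, Finset.sum_mul]
        refine Finset.sum_congr rfl fun i hi ↦ ?_
        obtain ⟨d, rfl⟩ := Nat.exists_eq_add_of_lt (Finset.mem_range.1 hi)
        have : i + d + 1 - 1 - i = d := by omega
        rw [this]
        have : b ^ d * b⁻¹ ^ d = 1 := by rw [← mul_pow, mul_inv_cancel₀ hb0, one_pow]
        linear_combination b * b ^ i * a i * this
      rw [mul_neg, this]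
      linear_combination b * hsum
    exact mul_left_cancel₀ (pow_ne_zero j hb0) h1
  have hV (V : ValuationSubring K) (hAV : ∀ c ∈ A, algebraMap k K c ∈ V) : y ∈ V ∧ y * b ∈ V := by
    rcases V.mem_or_inv_mem b with h | h
    · have : y ∈ V := sum_mem fun i _ ↦ MulMemClass.mul_mem (hAV _ (ha i)) (pow_mem h _)
      exact ⟨this, MulMemClass.mul_mem this h⟩
    · have : y * b ∈ V :=
        hyb ▸ NegMemClass.neg_mem (sum_mem fun i _ ↦
          MulMemClass.mul_mem (hAV _ (ha i)) (pow_mem h _))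
      exact ⟨by simpa [hb0] using MulMemClass.mul_mem this h, this⟩
  have integral_of_mem (x : K)
      (hx : ∀ V : ValuationSubring K, (∀ c ∈ A, algebraMap k K c ∈ V) → x ∈ V) :
      IsIntegral A x := by
    by_contra hxi
    have : IsIntegrallyClosedIn (integralClosure A K).toSubring K :=
      Subring.isIntegrallyClosedIn_iff.2 fun z hz ↦
        isIntegral_trans (R := A) (A := integralClosure A K) z hz
    obtain ⟨V, hV, hxV⟩ := Subring.exists_le_valuationSubring_of_isIntegrallyClosedIn
      (R := (integralClosure A K).toSubring) (x := x) hxi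
    exact hxV (hx V fun c hc ↦ hV (isIntegral_algebraMap (R := A) (x := (⟨c, hc⟩ : A))))
  refine ⟨y, ?_, integral_of_mem _ fun V h ↦ (hV V h).1, integral_of_mem _ fun V h ↦ (hV V h).2⟩
  have hy : y = 1 + ∑ i ∈ Finset.Ico (j + 1) (n + 1), a i * b ^ (i - j) := by
    simp only [y]
    rw [Finset.sum_eq_sum_Ico_succ_bot (by omega)]
    simp [a, hj]
  rw [hy]
  have hs : B.valuation (∑ i ∈ Finset.Ico (j + 1) (n + 1), a i * b ^ (i - j)) < 1 := by
    refine B.valuation.map_sum_lt one_ne_zero fun i hi ↦ ?_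
    rw [map_mul]
    refine mul_lt_one_of_lt_of_le (hlt i (by simp at hi; omega)) ?_
    exact (B.valuation_le_one_iff _).2 (pow_mem hb _)
  exact B.valuation.map_one_add_of_lt hs

/-- If the residue field of a valuation ring of `k` is finite, then every valuation ring of a Galois
extension `K` over it admits a Frobenius automorphism. -/
theorem exists_frobenius [IsGalois k K] (B : ValuationSubring K)
    [Finite (IsLocalRing.ResidueField (B.comap (algebraMap k K)))] :
    ∃ φ ∈ B.decompositionSubgroup k, ∀ b ∈ B, B.valuation (φ b -
      b ^ Nat.card (IsLocalRing.ResidueField (B.comap (algebraMap k K)))) < 1 := by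
  set A := B.comap (algebraMap k K) with hA
  let C := integralClosure A K
  have hAB (a : A) : algebraMap A K a ∈ B := a.2
  have hCB (c : C) : (c : K) ∈ B := by
    have := IsIntegrallyClosed.isIntegral_iff (R := B) (K := K) (x := (c : K))
    have hc : IsIntegral A (c : K) := c.2
    let g : A →+* B := (algebraMap A K).codRestrict B hAB
    have hg : IsIntegral B (c : K) := by
      obtain ⟨p, hp, hp'⟩ := hc
      refine ⟨p.map g, hp.map g, ?_⟩
      rw [Polynomial.eval₂_map]
      exact hp'
    obtain ⟨y, hy⟩ := this.1 hg
    exact hy ▸ y.2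
  let h : C →+* B := C.val.toRingHom.codRestrict B hCB
  let Q : Ideal C := (IsLocalRing.maximalIdeal B).comap h
  have hQ (c : C) : c ∈ Q ↔ B.valuation (c : K) < 1 := by
    rw [Ideal.mem_comap, valuation_lt_one_iff]; rfl
  let P := IsLocalRing.maximalIdeal A
  have hPQ : Q.LiesOver P := by
    constructor
    ext a
    rw [Ideal.mem_comap, hQ, valuation_lt_one_iff, ← mem_nonunits_iff, ← mem_nonunits_iff,
      ← inv_inv (a : k), ← inv_inv ((algebraMap A C a : C) : K), inv_mem_nonunits_iff,
      inv_mem_nonunits_iff, inv_eq_zero, inv_eq_zero]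
    change _ ↔ algebraMap k K a = 0 ∨ (algebraMap k K a)⁻¹ ∉ B
    rw [← map_inv₀, ← mem_comap (A := B), map_eq_zero]
  have : Algebra.IsInvariant A C (K ≃ₐ[k] K) := by
    constructor
    intro c hc
    obtain ⟨a, ha⟩ := (InfiniteGalois.mem_range_algebraMap_iff_fixed (k := k) (c : K)).2
      fun f ↦ congrArg Subtype.val (hc f)
    refine ⟨⟨a, ?_⟩, Subtype.ext ha⟩
    rw [mem_comap, ha]
    exact hCB c
  let : TopologicalSpace C := ⊥
  have : DiscreteTopology C := ⟨rfl⟩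
  have : ContinuousSMul (K ≃ₐ[k] K) C := by
    rw [continuousSMul_iff_stabilizer_isOpen]
    intro c
    convert! stabilizer_isOpen_of_isIntegral (K := k) (c : K) using 2
    ext g
    exact Subtype.ext_iff
  have : Finite (A ⧸ P) := ‹Finite (IsLocalRing.ResidueField A)›
  let : Fintype (A ⧸ P) := Fintype.ofFinite _
  let : Field (A ⧸ P) := Ideal.Quotient.field P
  have : Q.IsMaximal := Ideal.isMaximal_of_isIntegral_of_isMaximal_comap (R := A) Q
    (by rw [← Ideal.under_def, ← hPQ.over]; infer_instance)
  let : Field (C ⧸ Q) := Ideal.Quotient.field Q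
  have : Algebra.IsAlgebraic (A ⧸ P) (C ⧸ Q) := by
    have : Algebra.IsIntegral (A ⧸ P) (C ⧸ Q) := inferInstance
    exact Algebra.IsIntegral.isAlgebraic
  obtain ⟨⟨φ, hφ⟩, hφF⟩ := Ideal.Quotient.stabilizerHom_surjective_of_profinite
    (G := K ≃ₐ[k] K) P Q (FiniteField.frobeniusAlgEquivOfAlgebraic (A ⧸ P) (C ⧸ Q))
  have hcard : Fintype.card (A ⧸ P) = Nat.card (IsLocalRing.ResidueField A) :=
    Nat.card_eq_fintype_card.symm
  have hφC (c : C) : B.valuation (φ c - c ^ Nat.card (IsLocalRing.ResidueField A)) < 1 := by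
    have h1 := DFunLike.congr_fun hφF (Ideal.Quotient.mk Q c)
    rw [Ideal.Quotient.stabilizerHom_apply, FiniteField.coe_frobeniusAlgEquivOfAlgebraic, hcard]
      at h1
    dsimp only at h1
    rw [← map_pow] at h1
    exact (hQ _).1 (Ideal.Quotient.eq.1 h1)
  have hvC (ψ : K ≃ₐ[k] K) (c : C) : B.valuation (ψ c) ≤ 1 :=
    (B.valuation_le_one_iff _).2 (hCB (ψ • c))
  have hstab (ψ : K ≃ₐ[k] K) (hψ : ψ • Q = Q) (b : K) (hb : b ∈ B) : ψ b ∈ B := by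
    obtain ⟨y, hy, hyi, hyb⟩ := B.exists_isIntegral_mul_isIntegral (k := k) hb
    have h1 : B.valuation (ψ y) = 1 := by
      refine (hvC ψ ⟨y, hyi⟩).antisymm (not_lt.1 fun hlt ↦ ?_)
      have h2 : ψ • (⟨y, hyi⟩ : C) ∈ Q := (hQ _).2 hlt
      rw [← hψ, Ideal.smul_mem_pointwise_smul_iff, hQ] at h2
      exact h2.ne hy
    have h2 := hvC ψ ⟨y * b, hyb⟩
    rwa [map_mul, map_mul, h1, one_mul, valuation_le_one_iff] at h2
  have hφB (b : K) (hb : b ∈ B) : φ b ∈ B := hstab φ hφ b hb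
  have hφB' (b : K) (hb : b ∈ B) : φ⁻¹ b ∈ B :=
    hstab φ⁻¹ (inv_smul_eq_iff.2 (MulAction.mem_stabilizer_iff.1 hφ).symm) b hb
  refine ⟨φ, ?_, fun b hb ↦ ?_⟩
  · ext x
    rw [mem_smul_pointwise_iff_exists]
    constructor
    · rintro ⟨y, hy, rfl⟩
      exact hφB y hy
    · exact fun hx ↦ ⟨φ⁻¹ x, hφB' x hx, smul_inv_smul φ x⟩
  · obtain ⟨y, hy, hyi, hyb⟩ := B.exists_isIntegral_mul_isIntegral (k := k) hb
    set q := Nat.card (IsLocalRing.ResidueField A)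
    have h1 := hφC ⟨y, hyi⟩
    have h2 := hφC ⟨y * b, hyb⟩
    have h3 : y ^ q * (φ b - b ^ q) = (φ (y * b) - (y * b) ^ q) - (φ y - y ^ q) * φ b := by
      rw [map_mul]; ring
    have h4 : B.valuation (y ^ q * (φ b - b ^ q)) < 1 := by
      rw [h3]
      refine B.valuation.map_sub_lt h2 ?_
      rw [map_mul]
      exact mul_lt_one_of_lt_of_le h1 ((B.valuation_le_one_iff _).2 (hφB b hb))
    simpa [hy] using h4

theorem map_mem_iff_of_mem_decompositionSubgroup {B : ValuationSubring K} {δ : K ≃ₐ[k] K}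
    (hδ : δ ∈ B.decompositionSubgroup k) {x : K} : δ x ∈ B ↔ x ∈ B := by
  conv_lhs => rw [← MulAction.mem_stabilizer_iff.1 hδ]
  exact smul_mem_pointwise_smul_iff (g := δ)

/-- Elements of the decomposition group preserve the valuation of algebraic elements. -/
theorem valuation_map_of_mem_decompositionSubgroup [Algebra.IsAlgebraic k K]
    {B : ValuationSubring K} {δ : K ≃ₐ[k] K} (hδ : δ ∈ B.decompositionSubgroup k) (x : K) :
    B.valuation (δ x) = B.valuation x := by
  have hle {δ : K ≃ₐ[k] K} (hδ : δ ∈ B.decompositionSubgroup k) (y z : K) :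
      B.valuation (δ y) ≤ B.valuation (δ z) ↔ B.valuation y ≤ B.valuation z := by
    rcases eq_or_ne z 0 with rfl | hz
    · simp
    have hz' : 0 < B.valuation z := zero_lt_iff.2 (by simpa using hz)
    have hδz : 0 < B.valuation (δ z) := zero_lt_iff.2 (by simpa using hz)
    rw [← div_le_one₀ hz', ← div_le_one₀ hδz, ← map_div₀, ← map_div₀, ← map_div₀,
      valuation_le_one_iff, valuation_le_one_iff, map_mem_iff_of_mem_decompositionSubgroup hδ]
  have hnlt {δ : K ≃ₐ[k] K} (hδ : δ ∈ B.decompositionSubgroup k) :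
      ¬ B.valuation (δ x) < B.valuation x := by
    intro h
    have hanti : StrictAnti fun n : ℕ ↦ B.valuation ((δ ^ n) x) := by
      refine strictAnti_nat_of_succ_lt fun n ↦ ?_
      rw [pow_succ, AlgEquiv.mul_apply]
      exact lt_of_not_ge fun h' ↦ h.not_ge ((hle (pow_mem hδ n) _ _).1 h')
    have hinj : Function.Injective fun n : ℕ ↦ (δ ^ n) x :=
      .of_comp (f := B.valuation) hanti.injective
    refine Set.infinite_range_of_injective hinj
      (((minpoly k x).rootSet_finite K).subset ?_)
    rintro _ ⟨n, rfl⟩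
    rw [Polynomial.mem_rootSet]
    refine ⟨minpoly.ne_zero (Algebra.IsIntegral.isIntegral x), ?_⟩
    have h1 := Polynomial.aeval_algHom_apply (δ ^ n : K ≃ₐ[k] K).toAlgHom x (minpoly k x)
    rw [minpoly.aeval, map_zero] at h1
    exact h1
  refine le_antisymm (not_lt.1 fun h ↦ ?_) (not_lt.1 (hnlt hδ))
  refine hnlt (inv_mem hδ) ((lt_of_not_ge fun h' ↦ h.not_ge ?_))
  rw [← hle hδ] at h'
  have hx : δ (δ⁻¹ x) = x := smul_inv_smul δ x
  rwa [hx] at h'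

theorem valuation_map_sub_lt_one_of_mem_inertiaSubgroup {B : ValuationSubring K}
    {σ : B.decompositionSubgroup k} (hσ : σ ∈ B.inertiaSubgroup k) {b : K} (hb : b ∈ B) :
    B.valuation ((σ : K ≃ₐ[k] K) b - b) < 1 := by
  have h1 := DFunLike.congr_fun (MonoidHom.mem_ker.1 hσ) (IsLocalRing.residue B ⟨b, hb⟩)
  have h2 : IsLocalRing.residue B (σ • ⟨b, hb⟩) = IsLocalRing.residue B ⟨b, hb⟩ := h1
  rw [← sub_eq_zero, ← map_sub, IsLocalRing.residue_eq_zero_iff, valuation_lt_one_iff] at h2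
  exact h2

/-- An element of tame inertia which commutes with a Frobenius has order dividing `q - 1`. -/
theorem pow_apply_eq_self_of_mem_inertiaSubgroup [IsGalois k K] {B : ValuationSubring K}
    [Finite (IsLocalRing.ResidueField (B.comap (algebraMap k K)))]
    {σ : B.decompositionSubgroup k} (hσ : σ ∈ B.inertiaSubgroup k) (L : IntermediateField k K)
    (hL : ∀ x ∈ L, (σ : K ≃ₐ[k] K) x ∈ L)
    (hcomm : ∀ δ : K ≃ₐ[k] K, ∀ x ∈ L, δ ((σ : K ≃ₐ[k] K) x) = (σ : K ≃ₐ[k] K) (δ x))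
    {n : ℕ} (hn : B.valuation n = 1) (hσn : ∀ x ∈ L, ((σ : K ≃ₐ[k] K) ^ n) x = x)
    {x : K} (hx : x ∈ L) :
    ((σ : K ≃ₐ[k] K) ^ (Nat.card (IsLocalRing.ResidueField (B.comap (algebraMap k K))) - 1)) x
      = x := by
  obtain ⟨φ, hφ, hφB⟩ := B.exists_frobenius (k := k)
  set q := Nat.card (IsLocalRing.ResidueField (B.comap (algebraMap k K)))
  have hq : 1 < q := Finite.one_lt_card
  have hσ' {b : K} (hb : b ∈ B) := valuation_map_sub_lt_one_of_mem_inertiaSubgroup hσ hb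
  obtain ⟨σ, hσD⟩ := σ
  dsimp only at hσ' hL hcomm hσn ⊢
  clear hσ
  have hv {δ : K ≃ₐ[k] K} (hδ : δ ∈ B.decompositionSubgroup k) (x : K) :=
    valuation_map_of_mem_decompositionSubgroup hδ x
  have hunit {δ : K ≃ₐ[k] K} (hδ : δ ∈ B.decompositionSubgroup k) {x : K} (hx : x ≠ 0) :
      B.valuation (δ x / x) = 1 := by
    rw [map_div₀, hv hδ, div_self (by simpa using hx)]
  have hmem {x : K} (hx : B.valuation x = 1) : x ∈ B := (B.valuation_le_one_iff x).1 hx.le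
  have hiter {x : K} (hx : x ≠ 0) (j : ℕ) :
      B.valuation ((σ ^ j) x / x - (σ x / x) ^ j) < 1 := by
    induction j with
    | zero => simp [hx]
    | succ j ih =>
      have h1 := hσ' (hmem (hunit (pow_mem hσD j) hx))
      have hσx : σ x ≠ 0 := by simpa using hx
      have h2 : (σ ^ (j + 1)) x / x - (σ x / x) ^ (j + 1) =
          ((σ ((σ ^ j) x / x) - (σ ^ j) x / x) + ((σ ^ j) x / x - (σ x / x) ^ j)) * (σ x / x) := by
        rw [pow_succ' σ, AlgEquiv.mul_apply, map_div₀, pow_succ (σ x / x)]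
        generalize (σ x / x) ^ j = c
        field_simp
        ring
      rw [h2, map_mul, hunit hσD hx, mul_one]
      exact B.valuation.map_add_lt h1 ih
  have hroot {x : K} (hxL : x ∈ L) (hx : x ≠ 0) :
      B.valuation ((σ x / x) ^ (q - 1) - 1) < 1 := by
    set u := σ x / x
    have hu : B.valuation u = 1 := hunit hσD hx
    set w := φ x / x
    have hw : B.valuation w = 1 := hunit hφ hx
    have hw0 : w ≠ 0 := fun h ↦ by simp [h] at hw
    have hφx : φ x ≠ 0 := by simpa using hx
    have hσx : σ x ≠ 0 := by simpa using hx
    have h1 : φ u - u = (σ w - w) * (u / w) := by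
      simp only [u, w, map_div₀]
      rw [hcomm φ x hxL]
      field_simp
    have h2 : B.valuation (φ u - u) < 1 := by
      have huw : B.valuation (u / w) = 1 := by rw [map_div₀ B.valuation, hu, hw, div_one]
      rw [h1, map_mul, huw, mul_one]
      exact hσ' (hmem hw)
    have h3 : u * (u ^ (q - 1) - 1) = (φ u - u) - (φ u - u ^ q) := by
      have : u * u ^ (q - 1) = u ^ q := by rw [← pow_succ', Nat.sub_add_cancel hq.le]
      linear_combination this
    have h4 : B.valuation (u * (u ^ (q - 1) - 1)) < 1 := by
      rw [h3]
      exact B.valuation.map_sub_lt h2 (hφB u (hmem hu))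
    rwa [map_mul, hu, one_mul] at h4
  set s := σ ^ (q - 1)
  have hsD : s ∈ B.decompositionSubgroup k := pow_mem hσD _
  have hs {x : K} (hxL : x ∈ L) (hx : x ≠ 0) : B.valuation (s x - x) < B.valuation x := by
    have hx' : 0 < B.valuation x := zero_lt_iff.2 (by simpa using hx)
    have h1 := B.valuation.map_add_lt (hiter hx (q - 1)) (hroot hxL hx)
    rw [sub_add_sub_cancel, ← div_self hx, ← sub_div, map_div₀, div_lt_one₀ hx'] at h1
    exact h1
  have hpowL (m : ℕ) (x : K) (hx : x ∈ L) : (σ ^ m) x ∈ L := by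
    induction m with
    | zero => simpa
    | succ m ih => rw [pow_succ', AlgEquiv.mul_apply]; exact hL _ ih
  by_contra hne
  set z := s x - x
  have hz0 : z ≠ 0 := sub_ne_zero.2 hne
  have hzL : z ∈ L := sub_mem (hpowL _ _ hx) hx
  have hsi (i : ℕ) : B.valuation ((s ^ i) z - z) < B.valuation z := by
    induction i with
    | zero => simpa [zero_lt_iff] using hz0
    | succ i ih =>
      have h1 : (s ^ (i + 1)) z - z = s ((s ^ i) z - z) + (s z - z) := by
        rw [pow_succ', AlgEquiv.mul_apply, map_sub s ((s ^ i) z) z]; ring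
      rw [h1]
      exact B.valuation.map_add_lt ((hv hsD _).trans_lt ih) (hs hzL hz0)
  have hsum : ∑ i ∈ Finset.range n, (s ^ i) z = 0 := by
    have h1 (i : ℕ) : (s ^ i) z = (s ^ (i + 1)) x - (s ^ i) x := by
      rw [pow_succ, AlgEquiv.mul_apply, ← map_sub]
    have h2 : (s ^ n) x = x := by
      have (m : ℕ) : ((σ ^ n) ^ m) x = x := by
        induction m with
        | zero => simp
        | succ m ih => rw [pow_succ, AlgEquiv.mul_apply, hσn x hx, ih]
      rw [← pow_mul, mul_comm, pow_mul]
      exact this _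
    simp_rw [h1]
    rw [Finset.sum_range_sub (fun i ↦ (s ^ i) x), h2]
    simp
  have hnz : B.valuation (∑ i ∈ Finset.range n, ((s ^ i) z - z)) < B.valuation z :=
    B.valuation.map_sum_lt (by simpa using hz0) fun i _ ↦ hsi i
  rw [Finset.sum_sub_distrib, hsum] at hnz
  simp [hn] at hnz

end ValuationSubring

end PointwiseAction

/-- The residue field of a nontrivial valuation ring of a global function field is finite. -/
theorem FunctionField.finite_residueField {F k : Type*} [Field F] [Finite F] [Field k]
    [Algebra (RatFunc F) k] [FunctionField F k] (A : ValuationSubring k) (hA : A ≠ ⊤) :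
    Finite (IsLocalRing.ResidueField A) := by
  let : Algebra F k := ((algebraMap (RatFunc F) k).comp (algebraMap F (RatFunc F))).toAlgebra
  have : IsScalarTower F (RatFunc F) k := .of_algebraMap_eq fun _ ↦ rfl
  have hFA (c : F) : algebraMap F k c ∈ A := by
    have := FiniteField.valuation_algebraMap_le_one (v := A.valuation) c
    rwa [A.valuation_le_one_iff] at this
  let : Algebra F A := ((algebraMap F k).codRestrict A hFA).toAlgebra
  have : IsScalarTower F A k := .of_algebraMap_eq fun _ ↦ rfl
  obtain ⟨x, hx⟩ : ∃ x, x ∉ A := by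
    by_contra! h
    exact hA (eq_top_iff.2 fun x _ ↦ h x)
  have hx0 : x ≠ 0 := by rintro rfl; exact hx A.zero_mem
  have hxA : x⁻¹ ∈ A := (A.mem_or_inv_mem x).resolve_left hx
  let a : A := ⟨x⁻¹, hxA⟩
  have ha0 : (a : k) ≠ 0 := inv_ne_zero hx0
  have ham : a ∈ IsLocalRing.maximalIdeal A := by
    rw [A.valuation_lt_one_iff, ← A.mem_nonunits_iff, A.inv_mem_nonunits_iff]
    exact .inr hx
  have hat : Transcendental F (a : k) := by
    intro h
    have h1 : IsIntegral F x := by simpa [a] using h.isIntegral.inv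
    obtain ⟨y, hy⟩ := IsIntegrallyClosed.isIntegral_iff.1 (h1.tower_top (A := A))
    exact hx (hy ▸ y.2)
  have hfin := FunctionField.finiteDimensional_of_adjoin_transcendental hat
  have hrank : Module.rank F (IsLocalRing.ResidueField A) ≤
      Module.finrank (IntermediateField.adjoin F {(a : k)}) k := by
    refine rank_le fun s hs ↦ ?_
    choose b hb using IsLocalRing.residue_surjective (R := A)
    have hzero (p : s → Polynomial F) (hp : ∑ i, Polynomial.aeval a (p i) * b i = 0) (i : s) :
        (p i).coeff 0 = 0 := by
        have h1 := congrArg (IsLocalRing.residue A) hp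
        have ha : IsLocalRing.residue A a = 0 := (IsLocalRing.residue_eq_zero_iff a).2 ham
        have h2 (j : s) : IsLocalRing.residue A (Polynomial.aeval a (p j)) =
            algebraMap F _ ((p j).coeff 0) := by
          have := Polynomial.aeval_algebraMap_apply (IsLocalRing.ResidueField A) a (p j)
          rw [IsLocalRing.ResidueField.algebraMap_eq] at this
          rw [← this, ha, Polynomial.aeval_def, Polynomial.eval₂_at_zero]
        simp only [map_sum, map_mul, map_zero, hb, h2, ← Algebra.smul_def] at h1
        exact Fintype.linearIndependent_iff.1 hs _ h1 i
    have hdesc (n : ℕ) (p : s → Polynomial F)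
        (hp : ∑ i, Polynomial.aeval a (p i) * b i = 0) (i : s) : (p i).coeff n = 0 := by
      induction n generalizing p with
      | zero => exact hzero p hp i
      | succ n ih =>
        have h0 (j : s) : p j = Polynomial.X * (p j).divX := by
          conv_lhs => rw [← Polynomial.X_mul_divX_add (p j), hzero p hp j]
          simp
        rw [← Polynomial.coeff_divX]
        refine ih (fun j ↦ (p j).divX) ?_
        have h1 : a * ∑ j, Polynomial.aeval a (p j).divX * b j = 0 := by
          rw [← hp, Finset.mul_sum]
          refine Finset.sum_congr rfl fun j _ ↦ ?_
          conv_rhs => rw [h0 j]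
          rw [map_mul, Polynomial.aeval_X, mul_assoc]
        exact (mul_eq_zero.1 h1).resolve_left fun h ↦ ha0 (by simp [h])
    have hli : LinearIndependent (Algebra.adjoin F {(a : k)}) fun i : s ↦ (b i : k) := by
      rw [Fintype.linearIndependent_iff]
      intro g hg i
      have hgp (i : s) : ∃ p : Polynomial F, Polynomial.aeval (a : k) p = g i := by
        have := (g i).2
        exact (AlgHom.mem_range _).1 (Algebra.adjoin_singleton_eq_range_aeval F (a : k) ▸ this)
      choose p hp using hgp
      have : p i = 0 := by
        ext n
        refine hdesc n p ?_ i
        apply Subtype.ext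
        have hco (i : s) : ((Polynomial.aeval a (p i) : A) : k) = Polynomial.aeval (a : k) (p i) :=
          (Polynomial.aeval_algebraMap_apply k a (p i)).symm
        simpa [Algebra.smul_def, ← hp, hco] using hg
      exact Subtype.ext (by rw [← hp, this]; simp)
    open IntermediateField.algebraAdjoinAdjoin in
    rw [LinearIndependent.iff_fractionRing _ (IntermediateField.adjoin F {(a : k)})] at hli
    simpa using hli.fintype_card_le_finrank
  have : Module.Finite F (IsLocalRing.ResidueField A) :=
    Module.rank_lt_aleph0_iff.1 (hrank.trans_lt (Cardinal.natCast_lt_aleph0))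
  exact Module.finite_of_finite F

section Ultrametric

variable {E : Type*} [NormedField E] [IsUltrametricDist E]

theorem norm_eq_one_of_norm_sub_one_lt_one {u : E} (hu : ‖u - 1‖ < 1) : ‖u‖ = 1 := by
  have := IsUltrametricDist.norm_add_eq_max_of_norm_ne_norm (x := u - 1) (y := 1)
    (by rw [norm_one]; exact hu.ne)
  rwa [sub_add_cancel, norm_one, max_eq_right hu.le] at this

variable (E) in
/-- The units of an ultrametric field at distance `< r` from `1`. -/
def unitsBall (r : ℝ) (hr : 0 < r) (hr1 : r ≤ 1) : Subgroup Eˣ where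
  carrier := {u | ‖(u : E) - 1‖ < r}
  one_mem' := by simpa
  mul_mem' {u v} hu hv := by
    have h1 : ((u * v : Eˣ) : E) - 1 = u * (v - 1) + (u - 1) := by push_cast; ring
    have h2 : ‖(u : E)‖ = 1 := norm_eq_one_of_norm_sub_one_lt_one (hu.trans_le hr1)
    rw [Set.mem_ofPred_eq, h1]
    refine (IsUltrametricDist.norm_add_le_max _ _).trans_lt (max_lt ?_ hu)
    rw [norm_mul, h2, one_mul]
    exact hv
  inv_mem' {u} hu := by
    have h1 : ((u⁻¹ : Eˣ) : E) - 1 = - ((u⁻¹ : Eˣ) * (u - 1)) := by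
      rw [mul_sub, Units.inv_mul]; ring
    have h2 : ‖(u : E)‖ = 1 := norm_eq_one_of_norm_sub_one_lt_one (hu.trans_le hr1)
    have h3 : ‖((u⁻¹ : Eˣ) : E)‖ = 1 := by rw [Units.val_inv_eq_inv_val, norm_inv, h2, inv_one]
    rw [Set.mem_ofPred_eq, h1, norm_neg, norm_mul, h3, one_mul]
    exact hu

theorem isOpen_unitsBall (r : ℝ) (hr : 0 < r) (hr1 : r ≤ 1) :
    IsOpen (unitsBall E r hr hr1 : Set Eˣ) :=
  isOpen_lt (f := fun u : Eˣ ↦ ‖(u : E) - 1‖)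
    (Units.continuous_val.sub continuous_const).norm continuous_const

theorem norm_geom_sum_sub_natCast_le {u : E} (hu : ‖u - 1‖ < 1) (n : ℕ) :
    ‖∑ i ∈ Finset.range n, u ^ i - n‖ ≤ ‖u - 1‖ := by
  have h1 : ∑ i ∈ Finset.range n, u ^ i - n = ∑ i ∈ Finset.range n, (u ^ i - 1) := by simp
  rw [h1]
  refine IsUltrametricDist.norm_sum_le_of_forall_le_of_nonneg (norm_nonneg _) fun i _ ↦ ?_
  rw [← geom_sum_mul, norm_mul]
  refine mul_le_of_le_one_left (norm_nonneg _) ?_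
  refine IsUltrametricDist.norm_sum_le_of_forall_le_of_nonneg zero_le_one fun j _ ↦ ?_
  rw [norm_pow, norm_eq_one_of_norm_sub_one_lt_one hu, one_pow]

/-- Near `1`, raising to the power `m` multiplies the distance to `1` by `‖m‖`. -/
theorem norm_pow_sub_one_eq {r : ℝ} (hr1 : r ≤ 1)
    (hr : ∀ p : ℕ, p.Prime → r ≤ ‖(p : E)‖) (m : ℕ) {u : E} (hu : ‖u - 1‖ < r) :
    ‖u ^ m - 1‖ = ‖(m : E)‖ * ‖u - 1‖ := by
  induction m using induction_on_primes generalizing u with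
  | zero => simp
  | one => simp
  | prime_mul p a hp ih =>
    have h1 : ‖u ^ p - 1‖ = ‖(p : E)‖ * ‖u - 1‖ := by
      have h2 := (norm_geom_sum_sub_natCast_le (hu.trans_le hr1) p).trans_lt
        (hu.trans_le (hr p hp))
      have h3 := IsUltrametricDist.norm_add_eq_max_of_norm_ne_norm h2.ne
      rw [sub_add_cancel, max_eq_right h2.le] at h3
      rw [← geom_sum_mul, norm_mul, h3]
    have h2 : ‖u ^ p - 1‖ < r := by
      rw [h1]
      exact (mul_le_of_le_one_left (norm_nonneg _)
        (IsUltrametricDist.norm_natCast_le_one E p)).trans_lt hu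
    rw [pow_mul, ih h2, h1]
    push_cast
    rw [norm_mul]
    ring

end Ultrametric

/-- A continuous character of a Galois group with values in the units of an ultrametric field is
trivial on the elements of an inertia group which it maps close to `1`, if `‖ℓ‖ < 1` for
some `ℓ` prime to the residue characteristic, and the residue field of the base is finite. -/
theorem ValuationSubring.map_eq_one_of_mem_inertiaSubgroup {k K E : Type*} [Field k] [Field K]
    [Algebra k K] [IsGalois k K] [NormedField E] [IsUltrametricDist E] [CharZero E] {ℓ : ℕ}
    (hℓ1 : ‖(ℓ : E)‖ < 1) (hℓ : ∀ p : ℕ, p.Prime → ‖(ℓ : E)‖ ≤ ‖(p : E)‖)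
    {χ : (K ≃ₐ[k] K) →* Eˣ} (hχ : Continuous χ) {B : ValuationSubring K}
    [Finite (IsLocalRing.ResidueField (B.comap (algebraMap k K)))] (hB : B.valuation ℓ = 1)
    {σ : B.decompositionSubgroup k} (hσ : σ ∈ B.inertiaSubgroup k)
    (hχσ : ‖(χ σ : E) - 1‖ < ‖(ℓ : E)‖) : χ σ = 1 := by
  set q := Nat.card (IsLocalRing.ResidueField (B.comap (algebraMap k K)))
  have hq : 1 < q := Finite.one_lt_card
  have hℓ0 : 0 < ‖(ℓ : E)‖ := (norm_nonneg _).lt_of_ne' fun h ↦ by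
    have := Nat.cast_eq_zero.1 (norm_eq_zero.1 h)
    simp [this] at hB
  have hpow (m : ℕ) := norm_pow_sub_one_eq hℓ1.le hℓ m hχσ
  have hlim (n : ℕ) : ‖(χ σ : E) ^ (q - 1) - 1‖ < ‖(ℓ : E)‖ ^ (n + 1) := by
    have hr := pow_pos hℓ0 (n + 1)
    have hr1 := pow_le_one₀ hℓ0.le hℓ1.le (n := n + 1)
    let H : Subgroup (K ≃ₐ[k] K) := (unitsBall E (‖(ℓ : E)‖ ^ (n + 1)) hr hr1).comap χ
    have hHo : IsOpen (H : Set (K ≃ₐ[k] K)) := (isOpen_unitsBall _ hr hr1).preimage hχ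
    let H' : ClosedSubgroup (K ≃ₐ[k] K) := ⟨H, H.isClosed_of_isOpen hHo⟩
    let L := IntermediateField.fixedField H
    have hHL : L.fixingSubgroup = H := InfiniteGalois.fixingSubgroup_fixedField H'
    have hL {τ : K ≃ₐ[k] K} : τ ∈ H ↔ ∀ x ∈ L, τ x = x := by
      rw [← hHL, IntermediateField.mem_fixingSubgroup_iff]
    have hcomm (δ : K ≃ₐ[k] K) (x : K) (hx : x ∈ L) :
        δ ((σ : K ≃ₐ[k] K) x) = (σ : K ≃ₐ[k] K) (δ x) := by
      have h1 : (σ * δ : K ≃ₐ[k] K)⁻¹ * (δ * σ) ∈ H := by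
        rw [Subgroup.mem_comap, map_mul, map_inv, map_mul, map_mul, mul_comm (χ δ),
          inv_mul_cancel]
        exact (unitsBall E _ hr hr1).one_mem
      have h2 := congrArg (σ * δ : K ≃ₐ[k] K) (hL.1 h1 x hx)
      rw [← AlgEquiv.mul_apply, mul_inv_cancel_left] at h2
      exact h2
    have hσL (x : K) (hx : x ∈ L) : (σ : K ≃ₐ[k] K) x ∈ L := by
      rw [IntermediateField.mem_fixedField_iff]
      intro τ hτ
      rw [hcomm τ x hx, hL.1 hτ x hx]
    have hσn : (σ : K ≃ₐ[k] K) ^ ℓ ^ n ∈ H := by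
      change ‖((χ ((σ : K ≃ₐ[k] K) ^ ℓ ^ n) : Eˣ) : E) - 1‖ < _
      rw [map_pow, Units.val_pow_eq_pow_val, hpow, Nat.cast_pow, norm_pow, pow_succ]
      gcongr
    have hσq : (σ : K ≃ₐ[k] K) ^ (q - 1) ∈ H := hL.2 fun x hx ↦
      pow_apply_eq_self_of_mem_inertiaSubgroup hσ L hσL hcomm (by simp [hB]) (hL.1 hσn) hx
    change ‖((χ ((σ : K ≃ₐ[k] K) ^ (q - 1)) : Eˣ) : E) - 1‖ < _ at hσq
    rwa [map_pow, Units.val_pow_eq_pow_val] at hσq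
  have h0 : ‖(χ σ : E) ^ (q - 1) - 1‖ ≤ 0 :=
    ge_of_tendsto' ((tendsto_pow_atTop_nhds_zero_of_lt_one hℓ0.le hℓ1).comp
      (Filter.tendsto_add_atTop_nat 1)) fun n ↦ (hlim n).le
  rw [hpow] at h0
  have h1 := h0.antisymm (by positivity)
  rw [mul_eq_zero, norm_eq_zero, norm_eq_zero, Nat.cast_eq_zero, sub_eq_zero] at h1
  exact Units.ext (h1.resolve_left (by omega))

/-- **Lemma (char of function-field Galois group into ℓ-adic units has unramified power).**
Let `k` be a global function field of characteristic `p` (a finite extension of `RatFunc Fq`),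
`K` a separable closure of `k`, `ℓ ≠ p` a prime, `E` a finite extension of `ℚ_[ℓ]` with the
(unique) norm extending the `ℓ`-adic one, and `χ : Gal(K/k) → Eˣ` a continuous homomorphism.
Then some positive power `χ^N` is unramified at every place of `k`: for every nontrivial
valuation subring `A` of `k` (i.e. every place of `k`) and every valuation subring `B` of `K`
lying over `A`, the inertia subgroup of `B` is killed by `χ^N`. -/
theorem stmt0 (p ℓ : ℕ) [Fact p.Prime] [Fact ℓ.Prime] (hlp : ℓ ≠ p)
    (Fq : Type*) [Field Fq] [Fintype Fq] [CharP Fq p]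
    (k : Type*) [Field k] [Algebra (RatFunc Fq) k] [FunctionField Fq k]
    (K : Type*) [Field K] [Algebra k K] [IsSepClosure k K]
    (E : Type*) [NormedField E] [Algebra ℚ_[ℓ] E] [FiniteDimensional ℚ_[ℓ] E]
    (hnorm : ∀ x : ℚ_[ℓ], ‖algebraMap ℚ_[ℓ] E x‖ = ‖x‖)
    (χ : (K ≃ₐ[k] K) →* Eˣ) (hχ : Continuous χ) :
    ∃ N : ℕ, 0 < N ∧
      ∀ A : ValuationSubring k, A ≠ ⊤ →
        ∀ B : ValuationSubring K, B.comap (algebraMap k K) = A →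
          ∀ g : (B.inertiaSubgroup k),
            χ (((g : (B.decompositionSubgroup k)) : K ≃ₐ[k] K)) ^ N = 1 := by
  have hcast (n : ℕ) : ‖(n : E)‖ = ‖(n : ℚ_[ℓ])‖ := by rw [← hnorm, map_natCast]
  have : IsUltrametricDist E :=
    IsUltrametricDist.isUltrametricDist_of_forall_norm_natCast_le_one fun n ↦ by
      rw [hcast]; exact IsUltrametricDist.norm_natCast_le_one _ n
  have : CharZero E := charZero_of_injective_algebraMap (algebraMap ℚ_[ℓ] E).injective
  have hℓ1 : ‖(ℓ : E)‖ < 1 := by rw [hcast]; exact Padic.norm_p_lt_one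
  have hℓ0 : 0 < ‖(ℓ : E)‖ := norm_pos_iff.2 (Nat.cast_ne_zero.2 (Fact.out : ℓ.Prime).ne_zero)
  have hℓ (r : ℕ) (hr : r.Prime) : ‖(ℓ : E)‖ ≤ ‖(r : E)‖ := by
    by_cases h : r = ℓ
    · rw [h]
    · have h1 : ‖(r : E)‖ = 1 := by
        rw [hcast, Padic.norm_natCast_eq_one_iff]
        exact (Nat.coprime_primes Fact.out hr).2 (Ne.symm h)
      rw [h1]
      exact hℓ1.le
  let V : Subgroup (K ≃ₐ[k] K) := (unitsBall E ‖(ℓ : E)‖ hℓ0 hℓ1.le).comap χ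
  have hV : IsOpen (V : Set (K ≃ₐ[k] K)) := (isOpen_unitsBall _ hℓ0 hℓ1.le).preimage hχ
  have : Finite ((K ≃ₐ[k] K) ⧸ V) := V.quotient_finite_of_isOpen hV
  have : V.FiniteIndex := V.finiteIndex_of_finite_quotient
  refine ⟨V.index, Nat.pos_of_ne_zero V.index_ne_zero_of_finite, ?_⟩
  rintro A hA B rfl ⟨g, hg⟩
  have := FunctionField.finite_residueField (F := Fq) _ hA
  let : Algebra Fq K := ((algebraMap k K).comp
    ((algebraMap (RatFunc Fq) k).comp (algebraMap Fq (RatFunc Fq)))).toAlgebra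
  have hB : B.valuation ℓ = 1 := by
    rw [← map_natCast (algebraMap Fq K)]
    refine FiniteField.valuation_algebraMap_eq_one _ _ fun h ↦ hlp ?_
    exact ((Nat.prime_dvd_prime_iff_eq Fact.out Fact.out).1
      ((CharP.cast_eq_zero_iff Fq p ℓ).1 h)).symm
  have hgV : ((g : K ≃ₐ[k] K)) ^ V.index ∈ V := V.pow_index_mem _
  rw [← map_pow, ← SubmonoidClass.coe_pow]
  exact B.map_eq_one_of_mem_inertiaSubgroup hℓ1 hℓ hχ hB (pow_mem hg _) hgV
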